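/- Let (R, m) be a local regular domain. Then the order function ord_R, defined by ord_R(f) = max{l ≥ 0 : f ∈ m^l} for f ≠ 0, extends to a valuation of the field of fractions of R. Moreover, if x ∈ m \ m², S := R[m/x] and p := xS, then S_p is a valuation ring of this valuation. -/

import Mathlib

set_option synthInstance.maxHeartbeats 1000000
set_option maxHeartbeats 2000000

open IsLocalRing

noncomputable section

/-- The ideal generated by the nonunits of a ring (the maximal ideal, if the ring is local). -/
def nuIdeal (A : Type*) [CommRing A] : Ideal A := Ideal.span {a : A | ¬ IsUnit a}

/-- A commutative ring is regular local if it is a Noetherian local ring whose maximal ideal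
can be generated by `dim` elements. -/
def IsRegLoc (A : Type*) [CommRing A] : Prop :=
  IsLocalRing A ∧ IsNoetherianRing A ∧
    ∃ s : Finset A, (Ideal.span (s : Set A) = nuIdeal A) ∧
      ((s.card : ℕ) : WithBot (WithTop ℕ)) = ringKrullDim A

variable (R : Type*) [CommRing R] [IsDomain R]

/-- The ring `A[m_A/x]` inside the fraction field (where `m_A` is the ideal generated by
the nonunits of `A`, i.e. the maximal ideal when `A` is local). -/
def S1 (A : Subalgebra R (FractionRing R)) (x : A) : Subalgebra R (FractionRing R) :=
  Algebra.adjoin R ((A : Set (FractionRing R)) ∪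
    {z | ∃ a : A, a ∈ nuIdeal A ∧ z = (a : FractionRing R) / (x : FractionRing R)})

/-- The localization of a subalgebra `S` of the fraction field at a prime `p`, realized as a
subalgebra of the fraction field: `S[(S \ p)⁻¹]`. -/
def locSub (S : Subalgebra R (FractionRing R)) (p : Ideal S) : Subalgebra R (FractionRing R) :=
  Algebra.adjoin R ((S : Set (FractionRing R)) ∪
    {z | ∃ s : S, s ∉ p ∧ z = (s : FractionRing R)⁻¹})

/-- `x`, viewed as an element of `A[m_A/x]`. -/
def xIn (A : Subalgebra R (FractionRing R)) (x : A) : S1 R A x :=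
  ⟨(x : FractionRing R), Algebra.subset_adjoin (Or.inl x.2)⟩

/-- `B` is a (first) quadratic transform of `A`: there are `x ∈ m_A \ m_A²` and a prime ideal
`p` of `S := A[m_A/x]` containing `x` such that `B = S_p`. -/
def QuadStep (A B : Subalgebra R (FractionRing R)) : Prop :=
  ∃ x : A, x ∈ nuIdeal A ∧ x ∉ (nuIdeal A) ^ 2 ∧
    ∃ p : Ideal (S1 R A x), p.IsPrime ∧ xIn R A x ∈ p ∧ B = locSub R (S1 R A x) p

/-- The `m`-adic order function of a (local) ring: the largest `l` with `a ∈ m^l`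
(`⊤` for `a = 0`); here `m` is the ideal generated by the nonunits. -/
def ordLoc (A : Type*) [CommRing A] (a : A) : ℕ∞ :=
  sSup {nn : ℕ∞ | ∃ l : ℕ, nn = (l : ℕ∞) ∧ a ∈ nuIdeal A ^ l}

theorem MvPolynomial.IsHomogeneous.sum_support_eq {R ι : Type*} [CommSemiring R] {n : ℕ}
    {F : MvPolynomial ι R} (hF : F.IsHomogeneous n) {d : ι →₀ ℕ} (hd : d ∈ F.support) :
    ∑ i ∈ d.support, d i = n := by
  rw [← hF (mem_support_iff.mp hd)]
  simp [Finsupp.weight_apply, Finsupp.sum]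

theorem MvPolynomial.IsHomogeneous.aeval_mul_left {R A ι : Type*} [CommRing R] [CommRing A]
    [Algebra R A] {n : ℕ} {F : MvPolynomial ι R} (hF : F.IsHomogeneous n) (t : A) (y : ι → A) :
    MvPolynomial.aeval (fun i ↦ t * y i) F = t ^ n * MvPolynomial.aeval y F := by
  rw [aeval_def, aeval_def, MvPolynomial.eval₂_eq, MvPolynomial.eval₂_eq, Finset.mul_sum]
  refine Finset.sum_congr rfl fun d hd ↦ ?_
  simp_rw [mul_pow, Finset.prod_mul_distrib, Finset.prod_pow_eq_pow_sum, hF.sum_support_eq hd]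
  ring

open MvPolynomial in
/-- If the maximal ideal of a Noetherian local ring is generated by as many elements as its height,
then every homogeneous relation between these generators has all its coefficients in the maximal
ideal. -/
theorem map_residue_eq_zero_of_eval_eq_zero {R ι : Type*} [CommRing R] [IsLocalRing R]
    [IsNoetherianRing R] [Fintype ι] [Nonempty ι] {x : ι → R}
    (hx : Ideal.span (Set.range x) = maximalIdeal R)
    (hd : (Fintype.card ι : ℕ∞) ≤ (maximalIdeal R).height)
    {n : ℕ} {F : MvPolynomial ι R} (hF : F.IsHomogeneous n) (h0 : eval x F = 0) :
    map (residue R) F = 0 := by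
  classical
  by_contra hne
  let P : Ideal (MvPolynomial ι R) := RingHom.ker (map (residue R) : MvPolynomial ι R →+* _)
  have hPm : P = (maximalIdeal R).map C := by
    simp only [P, ker_map, ker_residue]
  have hPprime : P.IsPrime := RingHom.ker_isPrime _
  have hXP (i : ι) : (X i : MvPolynomial ι R) ∉ P := by simp [P, RingHom.mem_ker]
  have hover : P.LiesOver (maximalIdeal R) := ⟨by
    ext r
    simp [P, Ideal.under, RingHom.mem_ker, MvPolynomial.algebraMap_eq]⟩
  have hht : (maximalIdeal R).height ≤ P.height := by
    rw [Ideal.height_eq_height_add_of_liesOver_of_hasGoingDown (maximalIdeal R) P]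
    exact le_self_add
  obtain ⟨i₀⟩ := ‹Nonempty ι›
  let g : ι → MvPolynomial ι R := fun i ↦ X i₀ * C (x i) - X i * C (x i₀)
  let s : Finset (MvPolynomial ι R) := (Finset.univ.erase i₀).image g
  have hgs (Q : Ideal (MvPolynomial ι R)) (hQ : Ideal.span (s : Set _) ≤ Q) (i : ι) : g i ∈ Q := by
    by_cases hi : i = i₀
    · simp [g, hi]
    · exact hQ (Ideal.subset_span (by simpa [s] using ⟨i, hi, rfl⟩))
  have hgP : Ideal.span (s : Set _) ≤ P := by
    rw [Ideal.span_le]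
    intro f hf
    obtain ⟨i, -, rfl⟩ := Finset.mem_image.mp hf
    have hC (j : ι) : C (x j) ∈ P := by
      rw [hPm]
      exact Ideal.mem_map_of_mem _ (hx ▸ Ideal.subset_span ⟨j, rfl⟩)
    exact P.sub_mem (P.mul_mem_left _ (hC _)) (P.mul_mem_left _ (hC _))
  have hmin : P ∈ (Ideal.span (s : Set (MvPolynomial ι R))).minimalPrimes := by
    refine ⟨⟨hPprime, hgP⟩, fun Q ⟨hQ, hsQ⟩ hQP ↦ ?_⟩
    have key : C (x i₀) ^ n * F ∈ Q := by
      have h1 := hF.aeval_mul_left (X i₀) fun i ↦ (C (x i) : MvPolynomial ι R)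
      have h2 := hF.aeval_mul_left (C (x i₀)) (X : ι → MvPolynomial ι R)
      have h3 : aeval (fun i ↦ (C (x i) : MvPolynomial ι R)) F = 0 := by
        have := aeval_algebraMap_apply (MvPolynomial ι R) x F
        rwa [aeval_eq_eval, h0, map_zero] at this
      rw [h3, mul_zero] at h1
      rw [aeval_X_left_apply] at h2
      rw [← h2, ← sub_zero (aeval _ F), ← h1, ← Ideal.Quotient.eq]
      rw [← Ideal.Quotient.mkₐ_eq_mk R, ← AlgHom.comp_apply, ← AlgHom.comp_apply, comp_aeval,
        comp_aeval]
      congr 2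
      funext i
      have := hgs Q hsQ i
      simpa [mul_comm] using (Ideal.Quotient.eq.mpr this).symm
    have hx₀ : C (x i₀) ∈ Q :=
      hQ.mem_of_pow_mem _ ((hQ.mem_or_mem key).resolve_right fun h ↦ hne (hQP h))
    rw [hPm, Ideal.map_le_iff_le_comap, ← hx, Ideal.span_le]
    rintro _ ⟨i, rfl⟩
    have h3 : X i₀ * C (x i) ∈ Q := by
      have := Q.add_mem (hgs Q hsQ i) (Q.mul_mem_left (X i) hx₀)
      simpa [g] using this
    exact (hQ.mem_or_mem h3).resolve_left fun h ↦ hXP _ (hQP h)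
  have hcard : P.height ≤ s.card := Ideal.height_le_card_of_mem_minimalPrimes_span_finset hmin
  have hlt : s.card < Fintype.card ι :=
    Finset.card_image_le.trans_lt (Finset.card_erase_lt_of_mem (Finset.mem_univ _))
  have := (hd.trans hht).trans hcard
  exact absurd (Nat.cast_le.mp this) hlt.not_ge

open MvPolynomial in
theorem exists_isHomogeneous_map_residue_eq_zero {R ι : Type*} [CommRing R] [IsLocalRing R]
    {x : ι → R} (hx : Ideal.span (Set.range x) = maximalIdeal R) {n : ℕ} {y : R}
    (hy : y ∈ maximalIdeal R ^ (n + 1)) :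
    ∃ G : MvPolynomial ι R, G.IsHomogeneous n ∧ map (residue R) G = 0 ∧ eval x G = y := by
  rw [pow_succ'] at hy
  induction hy using Submodule.mul_induction_on' with
  | mem_mul_mem a ha b hb =>
    rw [← hx, Ideal.mem_span_pow_iff_exists_isHomogeneous] at hb
    obtain ⟨p, hp, rfl⟩ := hb
    refine ⟨C a * p, ?_, ?_, by simp⟩
    · simpa using (isHomogeneous_C ι a).mul hp
    · simp [(residue_eq_zero_iff a).mpr ha]
  | add a _ b _ ha hb =>
    obtain ⟨F, hF, hF', rfl⟩ := ha
    obtain ⟨G, hG, hG', rfl⟩ := hb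
    exact ⟨F + G, hF.add hG, by simp [hF', hG'], by simp⟩

open MvPolynomial in
theorem eval_mem_pow_succ {R ι : Type*} [CommRing R] [IsLocalRing R] {x : ι → R}
    (hx : ∀ i, x i ∈ maximalIdeal R) {n : ℕ} {F : MvPolynomial ι R} (hF : F.IsHomogeneous n)
    (h0 : map (residue R) F = 0) : eval x F ∈ maximalIdeal R ^ (n + 1) := by
  rw [eval_eq, pow_succ']
  refine Ideal.sum_mem _ fun d hd ↦ Ideal.mul_mem_mul ?_ ?_
  · rw [← residue_eq_zero_iff, ← coeff_map, h0, coeff_zero]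
  · rw [← hF.sum_support_eq hd, ← Finset.prod_pow_eq_pow_sum]
    exact Ideal.prod_mem_prod fun i _ ↦ Ideal.pow_mem_pow (hx i) _

open MvPolynomial in
/-- The associated graded ring of a regular local ring has no zero divisors. -/
theorem mul_notMem_pow_succ {R ι : Type*} [CommRing R] [IsLocalRing R]
    [IsNoetherianRing R] [Fintype ι] [Nonempty ι] {x : ι → R}
    (hx : Ideal.span (Set.range x) = maximalIdeal R)
    (hd : (Fintype.card ι : ℕ∞) ≤ (maximalIdeal R).height) {a b : ℕ} {f g : R}
    (hfa : f ∈ maximalIdeal R ^ a) (hf : f ∉ maximalIdeal R ^ (a + 1))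
    (hgb : g ∈ maximalIdeal R ^ b) (hg : g ∉ maximalIdeal R ^ (b + 1)) :
    f * g ∉ maximalIdeal R ^ (a + b + 1) := by
  intro hfg
  have hxm (i : ι) : x i ∈ maximalIdeal R := hx ▸ Ideal.subset_span ⟨i, rfl⟩
  rw [← hx, Ideal.mem_span_pow_iff_exists_isHomogeneous] at hfa hgb
  obtain ⟨F, hF, rfl⟩ := hfa
  obtain ⟨G, hG, rfl⟩ := hgb
  obtain ⟨H, hH, hH0, hHe⟩ := exists_isHomogeneous_map_residue_eq_zero hx hfg
  have := map_residue_eq_zero_of_eval_eq_zero hx hd ((hF.mul hG).sub hH) (by simp [hHe])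
  rw [map_sub, hH0, sub_zero, map_mul, mul_eq_zero] at this
  exact this.elim (fun h ↦ hf (eval_mem_pow_succ hxm hF h))
    (fun h ↦ hg (eval_mem_pow_succ hxm hG h))

theorem nuIdeal_eq_maximalIdeal (R : Type*) [CommRing R] [IsLocalRing R] :
    nuIdeal R = maximalIdeal R :=
  Ideal.span_eq (maximalIdeal R)

theorem IsRegLoc.exists_span_range_eq {R : Type*} [CommRing R] [IsLocalRing R] (h : IsRegLoc R) :
    ∃ s : Finset R, Ideal.span (Set.range ((↑) : s → R)) = maximalIdeal R ∧
      (Fintype.card s : ℕ∞) ≤ (maximalIdeal R).height := by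
  obtain ⟨-, -, s, hs, hcard⟩ := h
  refine ⟨s, ?_, ?_⟩
  · simpa [hs] using nuIdeal_eq_maximalIdeal R
  · rw [← maximalIdeal_height_eq_ringKrullDim] at hcard
    rw [Fintype.card_coe]
    exact (WithBot.coe_injective hcard).le

theorem natCast_le_ordLoc_iff {R : Type*} [CommRing R] [IsLocalRing R] {l : ℕ} {r : R} :
    (l : ℕ∞) ≤ ordLoc R r ↔ r ∈ maximalIdeal R ^ l := by
  rw [ordLoc, nuIdeal_eq_maximalIdeal]
  refine ⟨fun h ↦ ?_, fun h ↦ le_sSup ⟨l, rfl, h⟩⟩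
  cases l with
  | zero => simp
  | succ l =>
    obtain ⟨_, ⟨k, rfl, hk⟩, hlt⟩ :=
      lt_sSup_iff.mp (((Nat.cast_lt (α := ℕ∞)).mpr (Nat.lt_succ_self l)).trans_le h)
    exact Ideal.pow_le_pow_right (Nat.cast_lt.mp hlt) hk

theorem ordLoc_eq_natCast_iff {R : Type*} [CommRing R] [IsLocalRing R] {l : ℕ} {r : R} :
    ordLoc R r = l ↔ r ∈ maximalIdeal R ^ l ∧ r ∉ maximalIdeal R ^ (l + 1) := by
  rw [← natCast_le_ordLoc_iff, ← natCast_le_ordLoc_iff, not_le, le_antisymm_iff, and_comm]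
  push_cast
  rw [ENat.lt_add_one_iff (ENat.natCast_ne_top l)]

theorem ordLoc_eq_top_iff {R : Type*} [CommRing R] [IsLocalRing R] [IsNoetherianRing R] {r : R} :
    ordLoc R r = ⊤ ↔ r = 0 := by
  rw [ENat.eq_top_iff_forall_ge]
  simp_rw [natCast_le_ordLoc_iff]
  rw [← Submodule.mem_iInf, Ideal.iInf_pow_eq_bot_of_isLocalRing _ Ideal.IsPrime.ne_top',
    Ideal.mem_bot]

theorem ordLoc_zero {R : Type*} [CommRing R] [IsLocalRing R] : ordLoc R 0 = ⊤ :=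
  ENat.eq_top_iff_forall_ge.mpr fun _ ↦ natCast_le_ordLoc_iff.mpr (zero_mem _)

theorem ordLoc_one {R : Type*} [CommRing R] [IsLocalRing R] : ordLoc R 1 = 0 := by
  have : ordLoc R 1 = (0 : ℕ) := ordLoc_eq_natCast_iff.mpr ⟨by simp, by simp⟩
  simpa using this

theorem min_ordLoc_le_ordLoc_add {R : Type*} [CommRing R] [IsLocalRing R] (f g : R) :
    min (ordLoc R f) (ordLoc R g) ≤ ordLoc R (f + g) := by
  rw [← ENat.forall_natCast_le_iff_le]
  intro l hl
  rw [le_min_iff, natCast_le_ordLoc_iff, natCast_le_ordLoc_iff] at hl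
  exact natCast_le_ordLoc_iff.mpr (add_mem hl.1 hl.2)

theorem IsRegLoc.ordLoc_mul {R : Type*} [CommRing R] [IsLocalRing R] (h : IsRegLoc R)
    (hm : maximalIdeal R ≠ ⊥) (f g : R) : ordLoc R (f * g) = ordLoc R f + ordLoc R g := by
  have := h.2.1
  obtain ⟨s, hs, hcard⟩ := h.exists_span_range_eq
  have : Nonempty s := by
    by_contra hne
    rw [not_nonempty_iff] at hne
    exact hm (by rw [← hs, Set.range_eq_empty, Ideal.span_empty])
  by_cases hf : f = 0
  · simp [hf, ordLoc_zero]
  by_cases hg : g = 0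
  · simp [hg, ordLoc_zero]
  obtain ⟨a, ha⟩ := ENat.ne_top_iff_exists.mp (mt ordLoc_eq_top_iff.mp hf)
  obtain ⟨b, hb⟩ := ENat.ne_top_iff_exists.mp (mt ordLoc_eq_top_iff.mp hg)
  obtain ⟨hfa, hfa'⟩ := ordLoc_eq_natCast_iff.mp ha.symm
  obtain ⟨hgb, hgb'⟩ := ordLoc_eq_natCast_iff.mp hb.symm
  rw [← ha, ← hb, ← Nat.cast_add, ordLoc_eq_natCast_iff]
  exact ⟨pow_add (maximalIdeal R) a b ▸ Ideal.mul_mem_mul hfa hgb,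
    mul_notMem_pow_succ hs hcard hfa hfa' hgb hgb'⟩

/-- The order function of a regular local ring of positive dimension, as an additive valuation. -/
def IsRegLoc.ordValuation {R : Type*} [CommRing R] [IsLocalRing R] (h : IsRegLoc R)
    (hm : maximalIdeal R ≠ ⊥) : AddValuation R (WithTop ℤ) :=
  AddValuation.of (fun r ↦ (ordLoc R r).map (Nat.cast : ℕ → ℤ))
    (by simp [ordLoc_zero])
    (by simp [ordLoc_one])
    (fun f g ↦ by
      rw [← (ENat.map_natCast_strictMono (α := ℤ)).monotone.map_min]
      exact ENat.map_natCast_strictMono.monotone (min_ordLoc_le_ordLoc_add f g))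
    (fun f g ↦ by
      rw [h.ordLoc_mul hm]
      exact ENat.map_add (Nat.castAddMonoidHom ℤ) _ _)

theorem AddValuation.exists_extension_fractionRing {R Γ : Type*} [CommRing R] [IsDomain R]
    [LinearOrderedAddCommGroupWithTop Γ] (w : AddValuation R Γ) (hw : ∀ r, w r = ⊤ → r = 0) :
    ∃ v : AddValuation (FractionRing R) Γ, ∀ r, v (algebraMap R _ r) = w r := by
  let u : Valuation R (Multiplicative Γᵒᵈ) := AddValuation.toValuation w
  have hu : nonZeroDivisors R ≤ u.supp.primeCompl := fun r hr h ↦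
    nonZeroDivisors.ne_zero hr (hw r h)
  exact ⟨AddValuation.ofValuation (u.extendToLocalization hu (FractionRing R)), fun r ↦
    u.extendToLocalization_apply_map_apply hu (FractionRing R) r⟩

section BlowupChart

variable {R K : Type*} [CommRing R] [Field K] [Algebra R K] {I : Ideal R} {x : R}

theorem div_pow_mem_adjoin {n : ℕ} {f : R} (hf : f ∈ I ^ n) :
    algebraMap R K f / algebraMap R K x ^ n ∈
      Algebra.adjoin R {z : K | ∃ a ∈ I, z = algebraMap R K a / algebraMap R K x} := by
  induction n generalizing f with
  | zero => simp
  | succ n ih =>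
    rw [pow_succ] at hf
    induction hf using Submodule.mul_induction_on' with
    | mem_mul_mem a ha b hb =>
      rw [map_mul, pow_succ, mul_div_mul_comm]
      exact mul_mem (ih ha) (Algebra.subset_adjoin ⟨b, hb, rfl⟩)
    | add a _ b _ ha hb =>
      rw [map_add, add_div]
      exact add_mem ha hb

theorem exists_eq_div_pow_of_mem_adjoin (hx : x ∈ I) (hx0 : algebraMap R K x ≠ 0) {z : K}
    (hz : z ∈ Algebra.adjoin R {z : K | ∃ a ∈ I, z = algebraMap R K a / algebraMap R K x}) :
    ∃ n : ℕ, ∃ f ∈ I ^ n, z = algebraMap R K f / algebraMap R K x ^ n := by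
  induction hz using Algebra.adjoin_induction with
  | mem z hz =>
    obtain ⟨a, ha, rfl⟩ := hz
    exact ⟨1, a, by simpa using ha, by simp⟩
  | algebraMap r => exact ⟨0, r, by simp, by simp⟩
  | add y z _ _ hy hz =>
    obtain ⟨a, f, hf, rfl⟩ := hy
    obtain ⟨b, g, hg, rfl⟩ := hz
    refine ⟨a + b, f * x ^ b + x ^ a * g, ?_, ?_⟩
    · rw [pow_add]
      exact add_mem (Ideal.mul_mem_mul hf (Ideal.pow_mem_pow hx b))
        (Ideal.mul_mem_mul (Ideal.pow_mem_pow hx a) hg)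
    · simp only [map_add, map_mul, map_pow]
      field_simp
      ring
  | mul y z _ _ hy hz =>
    obtain ⟨a, f, hf, rfl⟩ := hy
    obtain ⟨b, g, hg, rfl⟩ := hz
    exact ⟨a + b, f * g, pow_add I a b ▸ Ideal.mul_mem_mul hf hg, by
      rw [map_mul, pow_add, mul_div_mul_comm]⟩

end BlowupChart

/-- Let `(R, m)` be a local regular domain.  Then the order function `ord_R`
extends to a (rank one discrete, additive) valuation `v` of the field of fractions of `R`.
Moreover, if `x ∈ m \ m²`, `S := R[m/x]` and `p := xS`, then `S_p` is a valuation ring of this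
valuation, i.e. `S_p = {z : Frac R | v z ≥ 0}`. -/
theorem order_function_is_valuation
    (R : Type*) [CommRing R] [IsDomain R] [IsLocalRing R] (hreg : IsRegLoc R)
    (x : R) (hx : x ∈ maximalIdeal R) (hx2 : x ∉ (maximalIdeal R) ^ 2)
    (S : Subalgebra R (FractionRing R))
    (hS : S = Algebra.adjoin R {z : FractionRing R | ∃ a ∈ maximalIdeal R,
      z = algebraMap R (FractionRing R) a / algebraMap R (FractionRing R) x})
    (p : Ideal S) (hp : p = Ideal.span {algebraMap R S x}) :
    ∃ v : AddValuation (FractionRing R) (WithTop ℤ),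
      (∀ r : R, v (algebraMap R (FractionRing R) r) = (ordLoc R r).map (Nat.cast : ℕ → ℤ)) ∧
      (∀ z : FractionRing R, z ∈ locSub R S p ↔ 0 ≤ v z) := by
  have := hreg.2.1
  have hx0 : x ≠ 0 := fun h ↦ hx2 (h ▸ zero_mem _)
  have hm : maximalIdeal R ≠ ⊥ := fun h ↦ hx0 (by simpa [h] using hx)
  obtain ⟨v, hv⟩ := (hreg.ordValuation hm).exists_extension_fractionRing
    fun r hr ↦ ordLoc_eq_top_iff.mp (ENat.map_eq_top_iff.mp hr)
  replace hv (r : R) : v (algebraMap R (FractionRing R) r) =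
    (ordLoc R r).map (Nat.cast : ℕ → ℤ) := hv r
  refine ⟨v, hv, ?_⟩
  set φ := algebraMap R (FractionRing R) with hφ
  have hφx : φ x ≠ 0 := by simpa [hφ] using hx0
  have hle (l : ℕ) (r : R) : ((l : ℤ) : WithTop ℤ) ≤ v (φ r) ↔ r ∈ maximalIdeal R ^ l := by
    rw [hv, ← natCast_le_ordLoc_iff, ← ENat.map_natCast_strictMono (α := ℤ) |>.le_iff_le,
      ENat.map_natCast]
  have heq (l : ℕ) (r : R) (h : ordLoc R r = l) : v (φ r) = ((l : ℤ) : WithTop ℤ) := by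
    rw [hv, h, ENat.map_natCast]
  have hvx : v (φ x) = ((1 : ℤ) : WithTop ℤ) :=
    heq 1 x (ordLoc_eq_natCast_iff.mpr ⟨by simpa using hx, hx2⟩)
  have hvxn (n : ℕ) : v (φ x ^ n) = ((n : ℤ) : WithTop ℤ) := by
    rw [AddValuation.map_pow, hvx, ← WithTop.coe_nsmul]
    simp
  have hdiv (l n : ℕ) (r : R) : ((l : ℤ) : WithTop ℤ) ≤ v (φ r / φ x ^ n) ↔
      r ∈ maximalIdeal R ^ (n + l) := by
    have hr : v (φ r) = v (φ r / φ x ^ n) + ((n : ℤ) : WithTop ℤ) := by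
      rw [← hvxn, ← v.map_mul, div_mul_cancel₀ _ (pow_ne_zero n hφx)]
    rw [← hle, hr]
    cases v (φ r / φ x ^ n) with
    | top => simp
    | coe k => norm_cast; omega
  have hSnonneg {z : FractionRing R} (hz : z ∈ S) : 0 ≤ v z := by
    rw [hS] at hz
    obtain ⟨n, f, hf, rfl⟩ := exists_eq_div_pow_of_mem_adjoin hx hφx hz
    simpa using (hdiv 0 n f).mpr hf
  have hSp (s : S) : s ∈ p ↔ ((1 : ℤ) : WithTop ℤ) ≤ v (s : FractionRing R) := by
    rw [hp, Ideal.mem_span_singleton]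
    refine ⟨?_, fun h ↦ ?_⟩
    · rintro ⟨t, rfl⟩
      have : v ((algebraMap R S x * t : S) : FractionRing R) = v (φ x) + v (t : FractionRing R) :=
        v.map_mul _ _
      rw [this, hvx]
      exact le_add_of_nonneg_right (hSnonneg t.2)
    · have hs := hS.le s.2
      obtain ⟨n, f, hf, hsf⟩ := exists_eq_div_pow_of_mem_adjoin hx hφx hs
      rw [hsf] at h
      have hmem := div_pow_mem_adjoin (K := FractionRing R) (x := x)
        ((hdiv 1 n f).mp (by simpa using h))
      rw [← hS] at hmem
      refine ⟨⟨_, hmem⟩, Subtype.ext ?_⟩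
      change (s : FractionRing R) = φ x * (φ f / φ x ^ (n + 1))
      rw [hsf]
      change φ f / φ x ^ n = _
      field_simp
      ring
  intro z
  refine ⟨fun hz ↦ ?_, fun hz ↦ ?_⟩
  · induction hz using Algebra.adjoin_induction with
    | mem z hz =>
      obtain hz | ⟨s, hs, rfl⟩ := hz
      · exact hSnonneg hz
      · rw [AddValuation.map_inv]
        have h0 := hSnonneg s.2
        rw [hSp] at hs
        cases hk : v (s : FractionRing R) with
        | top => simp [hk] at hs
        | coe k =>
          rw [hk] at h0 hs
          norm_cast at h0 hs
          obtain rfl : k = 0 := by omega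
          simp
    | algebraMap r => exact hSnonneg (S.algebraMap_mem r)
    | add y z _ _ hy hz => exact v.map_le_add hy hz
    | mul y z _ _ hy hz => exact v.map_mul y z ▸ add_nonneg hy hz
  · obtain ⟨f, g, hg, rfl⟩ := IsFractionRing.div_surjective (A := R) z
    have hg0 := nonZeroDivisors.ne_zero hg
    obtain ⟨n, hn⟩ := ENat.ne_top_iff_exists.mp (mt ordLoc_eq_top_iff.mp hg0)
    have hgn := ordLoc_eq_natCast_iff.mp hn.symm
    have hφg : φ g ≠ 0 := by simpa [hφ] using hg0
    have hfn : f ∈ maximalIdeal R ^ n := by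
      rw [← hle, ← heq n g hn.symm, ← div_mul_cancel₀ (φ f) hφg, v.map_mul]
      exact le_add_of_nonneg_left hz
    have hfS := div_pow_mem_adjoin (K := FractionRing R) (x := x) hfn
    have hgS := div_pow_mem_adjoin (K := FractionRing R) (x := x) hgn.1
    rw [← hS] at hfS hgS
    have hgp : (⟨_, hgS⟩ : S) ∉ p := by
      rw [hSp]
      exact fun h ↦ hgn.2 ((hdiv 1 n g).mp (by simpa using h))
    have : φ f / φ g = φ f / φ x ^ n * (φ g / φ x ^ n)⁻¹ := by
      field_simp
    rw [this]
    exact mul_mem (Algebra.subset_adjoin (Or.inl hfS))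
      (Algebra.subset_adjoin (Or.inr ⟨_, hgp, rfl⟩))

end
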